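/- arXiv:2401.17357 — 2 statements merged into one kernel-verified Lean document; each statement's English description precedes it below -/
import Mathlib

section
/- Let H and K be finite-dimensional complex inner product spaces, U a unitary operator on H, and λ ∈ ℂ. Let (e_j)_{j∈J} be an orthonormal basis of K and Ψ = Σ_{j∈J} ψ_j ⊗ e_j ∈ H ⊗ K, so that Ψ is a purification of ρ := Σ_{j∈J} |ψ_j⟩⟨ψ_j| (the partial trace of |Ψ⟩⟨Ψ| over K equals ρ). If U ρ = λ ρ, then (U ⊗ 1_K) Ψ = λ Ψ. -/
open Matrix Kronecker

/-- The rank-one operator `|ψ⟩⟨ψ| : v ↦ ⟨ψ, v⟩ ψ`, as a matrix. -/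
noncomputable def outer {ι : Type*} [Fintype ι] (ψ : ι → ℂ) : Matrix ι ι ℂ :=
  Matrix.of fun i j => ψ i * (starRingEnd ℂ) (ψ j)

/-- The sum of the projectors `|ψ_j⟩⟨ψ_j|` is `A Aᴴ`, where `A` has columns `ψ_j`. -/
theorem sum_outer_eq_mul_conjTranspose {ι J : Type*} [Fintype ι] [Fintype J] (ψ : J → ι → ℂ) :
    ∑ j, outer (ψ j) = (Matrix.of ψ)ᵀ * (Matrix.of ψ)ᵀᴴ := by
  ext a b
  simp [Matrix.sum_apply, Matrix.mul_apply, outer]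

open scoped ComplexOrder in
/-- If `U ρ = λ ρ` for `ρ = ∑ j, |ψ_j⟩⟨ψ_j|`, then every `ψ_j` satisfies `U ψ_j = λ ψ_j`. -/
theorem mulVec_eq_smul_of_mul_sum_outer {ι J : Type*} [Fintype ι] [DecidableEq ι] [Fintype J]
    {U : Matrix ι ι ℂ} {lam : ℂ} {ψ : J → ι → ℂ}
    (h : U * (∑ j, outer (ψ j)) = lam • ∑ j, outer (ψ j)) (j : J) :
    U *ᵥ ψ j = lam • ψ j := by
  have hzero : (U - lam • (1 : Matrix ι ι ℂ)) * (Matrix.of ψ)ᵀ = 0 := by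
    rw [← Matrix.mul_self_mul_conjTranspose_eq_zero, ← sum_outer_eq_mul_conjTranspose,
      Matrix.sub_mul, h, Matrix.smul_mul, Matrix.one_mul, sub_self]
  rw [Matrix.sub_mul, Matrix.smul_mul, Matrix.one_mul, sub_eq_zero] at hzero
  ext a
  simpa [Matrix.mul_apply, Matrix.mulVec, dotProduct] using congrFun (congrFun hzero a) j

/-- Any purification `Ψ = Σ_j ψ_j ⊗ e_j` (with `(e_j)` orthonormal in `K`) of a strongly
symmetric state `ρ = Σ_j |ψ_j⟩⟨ψ_j|` with `U ρ = λ ρ` is symmetric under the trivially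
extended unitary `U ⊗ 1_K`, with the same charge `λ`. -/
theorem purification_of_strongly_symmetric_is_symmetric
    {ι κ J : Type*} [Fintype ι] [DecidableEq ι] [Fintype κ] [DecidableEq κ]
    [Fintype J] [DecidableEq J]
    (U : Matrix ι ι ℂ) (hU : U ∈ Matrix.unitaryGroup ι ℂ) (lam : ℂ)
    (ψ : J → ι → ℂ) (e : J → κ → ℂ)
    (he : ∀ j k, ∑ x, (starRingEnd ℂ) (e j x) * e k x = if j = k then 1 else 0)
    (hρ : U * (∑ j, outer (ψ j)) = lam • ∑ j, outer (ψ j)) :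
    (U ⊗ₖ (1 : Matrix κ κ ℂ)).mulVec (fun p : ι × κ => ∑ j, ψ j p.1 * e j p.2)
      = lam • (fun p : ι × κ => ∑ j, ψ j p.1 * e j p.2) := by
  ext ⟨a, x⟩
  have hψ : ∀ j, ∑ b, U a b * ψ j b = lam * ψ j a := fun j =>
    congrFun (mulVec_eq_smul_of_mul_sum_outer hρ j) a
  simp only [Matrix.mulVec, dotProduct, Fintype.sum_prod_type, Matrix.kroneckerMap_apply,
    Matrix.one_apply, mul_ite, mul_one, mul_zero, ite_mul, zero_mul, Pi.smul_apply, smul_eq_mul]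
  simp only [Finset.sum_ite_eq, Finset.mem_univ, if_true, Finset.mul_sum]
  rw [Finset.sum_comm]
  refine Finset.sum_congr rfl fun j _ => ?_
  simp only [← mul_assoc]
  rw [← Finset.sum_mul, hψ]
end

section
/- Let H_A and H_B be finite-dimensional complex inner product spaces, F_A a unitary on H_A, F_B a unitary on H_B, λ ∈ ℂ, and let ρ = Σ_i p_i |a_i ⊗ b_i⟩⟨a_i ⊗ b_i| be a bipartite separable positive semidefinite operator on H_A ⊗ H_B (finitely many terms, p_i > 0, a_i ∈ H_A, b_i ∈ H_B) satisfying the strong symmetry condition (F_A ⊗ F_B) ρ = λ ρ. Let O_A be an operator on H_A that is charged under F_A, i.e., F_A O_A F_A† = −O_A, and let O_B be any operator on H_B. Then Tr[ρ (O_A ⊗ O_B)] = 0. -/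
open Matrix Kronecker

theorem outer_eq_vecMulVec {ι : Type*} [Fintype ι] (ψ : ι → ℂ) :
    outer ψ = vecMulVec ψ (star ψ) := rfl

theorem trace_outer_mul {ι : Type*} [Fintype ι] (ψ : ι → ℂ) (M : Matrix ι ι ℂ) :
    (outer ψ * M).trace = star ψ ⬝ᵥ M *ᵥ ψ := by
  rw [trace_mul_comm, outer_eq_vecMulVec, mul_vecMulVec, trace_vecMulVec, dotProduct_comm]

open scoped ComplexOrder in
/-- If `K` annihilates a positive combination of the `|ψ_i⟩⟨ψ_i|`, it annihilates every `ψ_i`. -/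
theorem mulVec_eq_zero_of_mul_sum_outer_eq_zero {ι σ : Type*} [Fintype ι] [Fintype σ]
    (K : Matrix ι ι ℂ) (p : σ → ℝ) (hp : ∀ i, 0 < p i) (ψ : σ → ι → ℂ)
    (h : K * ∑ i, (p i : ℂ) • outer (ψ i) = 0) (i : σ) : K *ᵥ ψ i = 0 := by
  have hsum : ∑ i, (p i : ℂ) * (star (K *ᵥ ψ i) ⬝ᵥ K *ᵥ ψ i) = 0 := by
    have htr : ((∑ i, (p i : ℂ) • outer (ψ i)) * (Kᴴ * K)).trace = 0 := by
      rw [← Matrix.mul_assoc, trace_mul_comm, ← Matrix.mul_assoc, h, Matrix.zero_mul, trace_zero]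
    simp only [Matrix.sum_mul, trace_sum, Matrix.smul_mul, trace_smul, trace_outer_mul,
      smul_eq_mul] at htr
    simpa only [star_mulVec, ← dotProduct_mulVec, mulVec_mulVec] using htr
  have hnonneg : ∀ i ∈ Finset.univ, 0 ≤ (p i : ℂ) * (star (K *ᵥ ψ i) ⬝ᵥ K *ᵥ ψ i) :=
    fun i _ => mul_nonneg (by exact_mod_cast (hp i).le) (dotProduct_star_self_nonneg _)
  have hi := (Finset.sum_eq_zero_iff_of_nonneg hnonneg).1 hsum i (Finset.mem_univ i)
  have hpi : (p i : ℂ) ≠ 0 := by exact_mod_cast (hp i).ne'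
  exact dotProduct_star_self_eq_zero.1 ((mul_eq_zero.1 hi).resolve_left hpi)

theorem kronecker_mulVec_mul {ι κ : Type*} [Fintype ι] [Fintype κ]
    (M : Matrix ι ι ℂ) (N : Matrix κ κ ℂ) (a : ι → ℂ) (b : κ → ℂ) :
    (M ⊗ₖ N) *ᵥ (fun q : ι × κ => a q.1 * b q.2) = fun q => (M *ᵥ a) q.1 * (N *ᵥ b) q.2 := by
  ext q
  simp only [mulVec, dotProduct, Fintype.sum_prod_type, Finset.sum_mul_sum, kroneckerMap_apply,
    mul_mul_mul_comm]

theorem star_mul_dotProduct_mul {ι κ : Type*} [Fintype ι] [Fintype κ]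
    (a c : ι → ℂ) (b d : κ → ℂ) :
    star (fun q : ι × κ => a q.1 * b q.2) ⬝ᵥ (fun q => c q.1 * d q.2) =
      (star a ⬝ᵥ c) * (star b ⬝ᵥ d) := by
  simp only [dotProduct, Fintype.sum_prod_type, Finset.sum_mul_sum, Pi.star_apply, star_mul',
    mul_mul_mul_comm]

open scoped ComplexOrder in
/-- A charged operator has vanishing expectation value in every eigenvector of the symmetry. -/
theorem dotProduct_charged_mulVec_eq_zero {ι : Type*} [Fintype ι] [DecidableEq ι]
    {F O : Matrix ι ι ℂ} (hF : F ∈ Matrix.unitaryGroup ι ℂ) (hO : F * O * Fᴴ = -O)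
    {a : ι → ℂ} {μ : ℂ} (ha : F *ᵥ a = μ • a) : star a ⬝ᵥ O *ᵥ a = 0 := by
  have hFF : Fᴴ * F = 1 := Matrix.mem_unitaryGroup_iff'.1 hF
  have hO' : O = -(Fᴴ * O * F) := by
    calc O = Fᴴ * F * O * (Fᴴ * F) := by simp [hFF]
      _ = Fᴴ * (F * O * Fᴴ) * F := by simp only [Matrix.mul_assoc]
      _ = -(Fᴴ * O * F) := by simp [hO]
  have hconj : star a ⬝ᵥ (Fᴴ * O * F) *ᵥ a = (star μ * μ) * (star a ⬝ᵥ O *ᵥ a) := by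
    rw [← mulVec_mulVec, ← mulVec_mulVec, dotProduct_mulVec, ← star_mulVec, ha, mulVec_smul,
      star_smul, smul_dotProduct, dotProduct_smul, smul_eq_mul, smul_eq_mul, mul_assoc]
  have hexp : star a ⬝ᵥ O *ᵥ a = -((star μ * μ) * (star a ⬝ᵥ O *ᵥ a)) := by
    rw [← hconj, ← dotProduct_neg, ← neg_mulVec, ← hO']
  have hne : 1 + star μ * μ ≠ 0 :=
    (add_pos_of_pos_of_nonneg one_pos (star_mul_self_nonneg μ)).ne'
  exact (mul_eq_zero.1 (by linear_combination hexp :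
    (1 + star μ * μ) * (star a ⬝ᵥ O *ᵥ a) = 0)).resolve_left hne

/-- If `a ⊗ b` is an eigenvector of `M ⊗ N` and `N b ≠ 0`, then `a` is an eigenvector of `M`. -/
theorem exists_mulVec_eq_smul_of_kronecker {ι κ : Type*} [Fintype ι] [Fintype κ]
    {M : Matrix ι ι ℂ} {N : Matrix κ κ ℂ} {a : ι → ℂ} {b : κ → ℂ} {lam : ℂ}
    (hN : N *ᵥ b ≠ 0)
    (h : (M ⊗ₖ N) *ᵥ (fun q : ι × κ => a q.1 * b q.2) = lam • fun q => a q.1 * b q.2) :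
    ∃ μ : ℂ, M *ᵥ a = μ • a := by
  obtain ⟨y, hy⟩ := Function.ne_iff.1 hN
  rw [Pi.zero_apply] at hy
  refine ⟨lam * b y / (N *ᵥ b) y, funext fun x => ?_⟩
  have hxy := congrFun h (x, y)
  rw [kronecker_mulVec_mul] at hxy
  simp only [Pi.smul_apply, smul_eq_mul] at hxy ⊢
  field_simp
  linear_combination hxy

/-- For a bipartite separable state `ρ = Σ_i p_i |a_i ⊗ b_i⟩⟨a_i ⊗ b_i|` that is strongly
symmetric under `F_A ⊗ F_B`, the two-point function of any operator `O_A` charged under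
`F_A` (i.e. `F_A O_A F_A† = −O_A`) with any `O_B` vanishes: `Tr[ρ (O_A ⊗ O_B)] = 0`. -/
theorem charged_two_point_function_vanishes_on_separable_symmetric_state
    {ι κ : Type*} [Fintype ι] [DecidableEq ι] [Fintype κ] [DecidableEq κ]
    (FA : Matrix ι ι ℂ) (hFA : FA ∈ Matrix.unitaryGroup ι ℂ)
    (FB : Matrix κ κ ℂ) (hFB : FB ∈ Matrix.unitaryGroup κ ℂ)
    (lam : ℂ) (n : ℕ) (p : Fin n → ℝ) (hp : ∀ i, 0 < p i)
    (a : Fin n → ι → ℂ) (b : Fin n → κ → ℂ)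
    (ρ : Matrix (ι × κ) (ι × κ) ℂ)
    (hρdef : ρ = ∑ i, (p i : ℂ) • outer (fun q : ι × κ => a i q.1 * b i q.2))
    (hsym : (FA ⊗ₖ FB) * ρ = lam • ρ)
    (OA : Matrix ι ι ℂ) (hOA : FA * OA * FAᴴ = -OA)
    (OB : Matrix κ κ ℂ) :
    (ρ * (OA ⊗ₖ OB)).trace = 0 := by
  subst hρdef
  simp only [Matrix.sum_mul, trace_sum, Matrix.smul_mul, trace_smul, trace_outer_mul]
  refine Finset.sum_eq_zero fun i _ => ?_
  rw [kronecker_mulVec_mul, star_mul_dotProduct_mul]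
  by_cases hb : b i = 0
  · simp [hb]
  have hFBb : FB *ᵥ b i ≠ 0 := fun h0 => hb <| by
    rw [← one_mulVec (b i), ← Matrix.mem_unitaryGroup_iff'.1 hFB, ← mulVec_mulVec, h0,
      mulVec_zero]
  have hker := mulVec_eq_zero_of_mul_sum_outer_eq_zero
    (FA ⊗ₖ FB - lam • 1) p hp (fun i q => a i q.1 * b i q.2)
    (by rw [Matrix.sub_mul, hsym, Matrix.smul_mul, Matrix.one_mul, sub_self]) i
  rw [sub_mulVec, smul_mulVec, one_mulVec, sub_eq_zero] at hker
  obtain ⟨μ, hμ⟩ := exists_mulVec_eq_smul_of_kronecker hFBb hker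
  rw [dotProduct_charged_mulVec_eq_zero hFA hOA hμ, zero_mul, smul_zero]
end
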